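/- Let τ > 0, d ≥ 1, n ≥ 1, and let G_τ(x) = (4πτ)^{−d/2} exp(−‖x‖²/(4τ)) be the Gaussian heat kernel on ℝ^d. For integrable measurable functions u₁, …, u_n : ℝ^d → [0,1] with Σ_{i=1}^n u_i(x) ≤ 1 for a.e. x, set u₀ = 1 − Σ_{i=1}^n u_i and define E^τ(u₁,…,u_n) = Σ_{i=0}^n ∫_{ℝ^d} u_i(x) (G_τ * (1 − u_i))(x) dx, which is finite. Then E^τ is concave on this convex set: for any two such tuples u = (u_i) and v = (v_i) and any θ ∈ [0,1], E^τ(θu + (1−θ)v) ≥ θ E^τ(u) + (1−θ) E^τ(v). -/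

import Mathlib

open MeasureTheory Real

/-- The Gaussian heat kernel `G_τ(x) = (4πτ)^{-d/2} exp(-‖x‖²/(4τ))` on `ℝ^d`. -/
noncomputable def heatKernel (d : ℕ) (τ : ℝ) (x : EuclideanSpace ℝ (Fin d)) : ℝ :=
  (4 * π * τ) ^ (-(d : ℝ) / 2) * Real.exp (-‖x‖ ^ 2 / (4 * τ))

/-- Convolution with the Gaussian heat kernel. -/
noncomputable def heatConv (d : ℕ) (τ : ℝ) (u : EuclideanSpace ℝ (Fin d) → ℝ)
    (x : EuclideanSpace ℝ (Fin d)) : ℝ :=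
  ∫ y, heatKernel d τ (x - y) * u y

/-- The multiphase threshold-dynamics energy
`E^τ(u₁,…,uₙ) = ∑_{i=0}^n ∫ uᵢ (G_τ * (1 - uᵢ))`, where `u₀ = 1 - ∑_{i=1}^n uᵢ` is the
exterior phase and `G_τ * (1 - w) = 1 - G_τ * w`. -/
noncomputable def multiEnergy (d n : ℕ) (τ : ℝ)
    (u : Fin n → EuclideanSpace ℝ (Fin d) → ℝ) : ℝ :=
  (∫ x, (1 - ∑ i, u i x) * (1 - heatConv d τ (fun y => 1 - ∑ i, u i y) x)) +
    ∑ i, ∫ x, u i x * (1 - heatConv d τ (u i) x)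

section HeatKernel

variable {d : ℕ} {τ : ℝ}

theorem continuous_heatKernel (d : ℕ) (τ : ℝ) : Continuous (heatKernel d τ) := by
  unfold heatKernel
  fun_prop

theorem heatKernel_nonneg (hτ : 0 < τ) (x : EuclideanSpace ℝ (Fin d)) :
    0 ≤ heatKernel d τ x := by
  unfold heatKernel
  positivity

theorem heatKernel_le (hτ : 0 < τ) (x : EuclideanSpace ℝ (Fin d)) :
    heatKernel d τ x ≤ (4 * π * τ) ^ (-(d : ℝ) / 2) := by
  unfold heatKernel
  refine mul_le_of_le_one_right (by positivity) (Real.exp_le_one_iff.2 ?_)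
  rw [neg_div]
  exact neg_nonpos.2 (by positivity)

theorem norm_heatKernel_le (hτ : 0 < τ) (x : EuclideanSpace ℝ (Fin d)) :
    ‖heatKernel d τ x‖ ≤ (4 * π * τ) ^ (-(d : ℝ) / 2) := by
  rw [Real.norm_of_nonneg (heatKernel_nonneg hτ x)]
  exact heatKernel_le hτ x

theorem heatKernel_neg (x : EuclideanSpace ℝ (Fin d)) :
    heatKernel d τ (-x) = heatKernel d τ x := by
  simp [heatKernel]

theorem integral_heatKernel (hτ : 0 < τ) : ∫ x, heatKernel d τ x = 1 := by
  have h := GaussianFourier.integral_rexp_neg_mul_sq_norm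
    (V := EuclideanSpace ℝ (Fin d)) (b := 1 / (4 * τ)) (by positivity)
  have hexp (x : EuclideanSpace ℝ (Fin d)) :
      -‖x‖ ^ 2 / (4 * τ) = -(1 / (4 * τ)) * ‖x‖ ^ 2 := by ring
  have hbase : π / (1 / (4 * τ)) = 4 * π * τ := by field_simp
  simp only [heatKernel, integral_const_mul, hexp, h, finrank_euclideanSpace,
    Fintype.card_fin, hbase]
  rw [← Real.rpow_add (by positivity), neg_div, neg_add_cancel, Real.rpow_zero]

theorem integrable_heatKernel (hτ : 0 < τ) : Integrable (heatKernel d τ) := by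
  by_contra h
  simpa [integral_undef h] using integral_heatKernel (d := d) hτ

/-- A Gaussian is, up to a nonnegative constant, the self-convolution of a narrower Gaussian. -/
theorem exists_heatKernel_sub_eq_integral (hτ : 0 < τ) :
    ∃ c : ℝ, 0 ≤ c ∧ ∀ x y : EuclideanSpace ℝ (Fin d), heatKernel d τ (x - y) =
      c * ∫ z, heatKernel d (τ / 2) (x - z) * heatKernel d (τ / 2) (z - y) := by
  have hquarter : 0 < τ / 4 := by positivity
  set A := (4 * π * τ) ^ (-(d : ℝ) / 2) with hA
  set B := (4 * π * (τ / 2)) ^ (-(d : ℝ) / 2) with hB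
  set C := (4 * π * (τ / 4)) ^ (-(d : ℝ) / 2) with hC
  have hApos : 0 < A := by positivity
  have hBpos : 0 < B := by positivity
  have hCpos : 0 < C := by positivity
  refine ⟨A * C / B ^ 2, by positivity, fun x y => ?_⟩
  have key (z : EuclideanSpace ℝ (Fin d)) :
      heatKernel d (τ / 2) (x - z) * heatKernel d (τ / 2) (z - y) =
        (B ^ 2 / (A * C) * heatKernel d τ (x - y)) *
          heatKernel d (τ / 4) (z - (1 / 2 : ℝ) • (x + y)) := by
    have hpar := parallelogram_law_with_norm ℝ (z - (1 / 2 : ℝ) • (x + y))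
      ((1 / 2 : ℝ) • (x - y))
    have h₁ : z - (1 / 2 : ℝ) • (x + y) + (1 / 2 : ℝ) • (x - y) = z - y := by module
    have h₂ : z - (1 / 2 : ℝ) • (x + y) - (1 / 2 : ℝ) • (x - y) = -(x - z) := by module
    rw [h₁, h₂, norm_neg, norm_smul (1 / 2 : ℝ) (x - y), Real.norm_of_nonneg (by norm_num)] at hpar
    have hexp : -‖x - z‖ ^ 2 / (4 * (τ / 2)) + -‖z - y‖ ^ 2 / (4 * (τ / 2)) =
        -‖x - y‖ ^ 2 / (4 * τ) + -‖z - (1 / 2 : ℝ) • (x + y)‖ ^ 2 / (4 * (τ / 4)) := by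
      field_simp
      linarith
    simp only [heatKernel, ← hA, ← hB, ← hC]
    calc _ = B ^ 2 * Real.exp (-‖x - z‖ ^ 2 / (4 * (τ / 2)) +
          -‖z - y‖ ^ 2 / (4 * (τ / 2))) := by rw [Real.exp_add]; ring
      _ = _ := by
        rw [hexp, Real.exp_add]
        field_simp
  simp only [key, integral_const_mul]
  rw [integral_sub_right_eq_self (heatKernel d (τ / 4)), integral_heatKernel hquarter]
  field_simp

end HeatKernel

section HeatConv

variable {d : ℕ} {τ : ℝ} {f g : EuclideanSpace ℝ (Fin d) → ℝ}

theorem integrable_heatKernel_sub (hτ : 0 < τ) (x : EuclideanSpace ℝ (Fin d)) :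
    Integrable fun y => heatKernel d τ (x - y) :=
  (integrable_heatKernel hτ).comp_sub_left x

theorem integrable_heatKernel_sub_mul (hτ : 0 < τ) (hf : Integrable f)
    (x : EuclideanSpace ℝ (Fin d)) : Integrable fun y => heatKernel d τ (x - y) * f y :=
  hf.bdd_mul ((continuous_heatKernel d τ).comp (by fun_prop)).aestronglyMeasurable
    (.of_forall fun _ => norm_heatKernel_le hτ _)

theorem heatConv_eq_convolution (f : EuclideanSpace ℝ (Fin d) → ℝ) :
    heatConv d τ f =
      MeasureTheory.convolution f (heatKernel d τ) (ContinuousLinearMap.mul ℝ ℝ) volume := by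
  ext x
  simp only [heatConv, MeasureTheory.convolution, ContinuousLinearMap.mul_apply', mul_comm]

theorem integrable_heatConv (hτ : 0 < τ) (hf : Integrable f) : Integrable (heatConv d τ f) := by
  rw [heatConv_eq_convolution]
  exact hf.integrable_convolution _ (integrable_heatKernel hτ)

theorem integral_heatConv (hτ : 0 < τ) (hf : Integrable f) :
    ∫ x, heatConv d τ f x = ∫ x, f x := by
  rw [heatConv_eq_convolution, integral_convolution _ hf (integrable_heatKernel hτ),
    integral_heatKernel hτ]
  simp

theorem norm_heatConv_le (hτ : 0 < τ) (hf : Integrable f) (x : EuclideanSpace ℝ (Fin d)) :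
    ‖heatConv d τ f x‖ ≤ (4 * π * τ) ^ (-(d : ℝ) / 2) * ∫ y, ‖f y‖ := by
  rw [← integral_const_mul]
  refine norm_integral_le_of_norm_le (hf.norm.const_mul _) (.of_forall fun y => ?_)
  rw [norm_mul]
  gcongr
  exact norm_heatKernel_le hτ _

theorem heatConv_linear_combination (hτ : 0 < τ) (hf : Integrable f) (hg : Integrable g)
    (a b : ℝ) (x : EuclideanSpace ℝ (Fin d)) :
    heatConv d τ (fun y => a * f y + b * g y) x =
      a * heatConv d τ f x + b * heatConv d τ g x := by
  unfold heatConv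
  rw [← integral_const_mul, ← integral_const_mul,
    ← integral_add ((integrable_heatKernel_sub_mul hτ hf x).const_mul a)
      ((integrable_heatKernel_sub_mul hτ hg x).const_mul b)]
  congr with y
  ring

theorem heatConv_one_sub (hτ : 0 < τ) (hf : Integrable f) (x : EuclideanSpace ℝ (Fin d)) :
    heatConv d τ (fun y => 1 - f y) x = 1 - heatConv d τ f x := by
  have hone : ∫ y, heatKernel d τ (x - y) = 1 := by
    rw [integral_sub_left_eq_self (heatKernel d τ), integral_heatKernel hτ]
  unfold heatConv
  simp only [mul_sub, mul_one]
  rw [integral_sub (integrable_heatKernel_sub hτ x) (integrable_heatKernel_sub_mul hτ hf x), hone]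

theorem integrable_mul_heatConv (hτ : 0 < τ) (hf : Integrable f) (hg : Integrable g) :
    Integrable fun x => f x * heatConv d τ g x :=
  hf.mul_bdd (integrable_heatConv hτ hg).aestronglyMeasurable
    (.of_forall fun _ => norm_heatConv_le hτ hg _)

/-- The quadratic form of the heat kernel is positive semidefinite. -/
theorem integral_mul_heatConv_self_nonneg (hτ : 0 < τ) (hf : Integrable f) :
    0 ≤ ∫ x, f x * heatConv d τ f x := by
  obtain ⟨c, hc, hker⟩ := exists_heatKernel_sub_eq_integral (d := d) hτ
  have hhalf : 0 < τ / 2 := by positivity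
  have hff : Integrable (fun p : EuclideanSpace ℝ (Fin d) × EuclideanSpace ℝ (Fin d) =>
      f p.1 * f p.2) (volume.prod volume) := hf.mul_prod hf
  have hpair : Integrable (fun p : EuclideanSpace ℝ (Fin d) × EuclideanSpace ℝ (Fin d) =>
      f p.1 * f p.2 * heatKernel d τ (p.1 - p.2)) (volume.prod volume) :=
    hff.mul_bdd ((continuous_heatKernel d τ).comp (by fun_prop)).aestronglyMeasurable
      (.of_forall fun _ => norm_heatKernel_le hτ _)
  have hsmooth : Continuous (heatKernel d (τ / 2)) := continuous_heatKernel d (τ / 2)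
  have hpartial : Integrable (fun q : (EuclideanSpace ℝ (Fin d) × EuclideanSpace ℝ (Fin d)) ×
      EuclideanSpace ℝ (Fin d) => f q.1.1 * f q.1.2 * heatKernel d (τ / 2) (q.1.1 - q.2))
      ((volume.prod volume).prod volume) := by
    refine (integrable_prod_iff ?_).2 ⟨.of_forall fun p => ?_, ?_⟩
    · exact hff.aestronglyMeasurable.comp_fst.mul
        (hsmooth.comp (by fun_prop)).aestronglyMeasurable
    · exact (integrable_heatKernel_sub hhalf p.1).const_mul (f p.1 * f p.2)
    · convert hff.norm using 2 with p
      simp only [norm_mul, Real.norm_of_nonneg (heatKernel_nonneg hhalf _), integral_const_mul]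
      rw [integral_sub_left_eq_self (heatKernel d (τ / 2)), integral_heatKernel hhalf, mul_one]
  have htriple : Integrable (fun q : (EuclideanSpace ℝ (Fin d) × EuclideanSpace ℝ (Fin d)) ×
      EuclideanSpace ℝ (Fin d) => f q.1.1 * f q.1.2 * heatKernel d (τ / 2) (q.1.1 - q.2) *
        heatKernel d (τ / 2) (q.2 - q.1.2)) ((volume.prod volume).prod volume) :=
    hpartial.mul_bdd (hsmooth.comp (by fun_prop)).aestronglyMeasurable
      (.of_forall fun _ => norm_heatKernel_le hhalf _)
  have hsquare : ∫ x, f x * heatConv d τ f x =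
      c * ∫ z, (∫ x, f x * heatKernel d (τ / 2) (x - z)) ^ 2 := by
    calc ∫ x, f x * heatConv d τ f x
        = ∫ x, ∫ y, f x * f y * heatKernel d τ (x - y) := by
          unfold heatConv
          simp only [← integral_const_mul]
          congr with x
          congr with y
          ring
      _ = ∫ p : EuclideanSpace ℝ (Fin d) × EuclideanSpace ℝ (Fin d),
            f p.1 * f p.2 * heatKernel d τ (p.1 - p.2) ∂(volume.prod volume) :=
          (integral_prod _ hpair).symm
      _ = c * ∫ p : EuclideanSpace ℝ (Fin d) × EuclideanSpace ℝ (Fin d), ∫ z,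
            f p.1 * f p.2 * heatKernel d (τ / 2) (p.1 - z) * heatKernel d (τ / 2) (z - p.2)
            ∂volume ∂(volume.prod volume) := by
          rw [← integral_const_mul]
          congr with p
          simp only [hker, mul_assoc, integral_const_mul]
          ring
      _ = c * ∫ z, ∫ p : EuclideanSpace ℝ (Fin d) × EuclideanSpace ℝ (Fin d),
            f p.1 * f p.2 * heatKernel d (τ / 2) (p.1 - z) * heatKernel d (τ / 2) (z - p.2)
            ∂(volume.prod volume) := by
          rw [integral_integral_swap htriple]
      _ = c * ∫ z, (∫ x, f x * heatKernel d (τ / 2) (x - z)) ^ 2 := by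
          congr with z
          rw [sq, ← integral_prod_mul]
          congr with p
          rw [← neg_sub p.2 z, heatKernel_neg]
          ring
  rw [hsquare]
  exact mul_nonneg hc (integral_nonneg fun _ => sq_nonneg _)

/-- The quadratic form of the heat kernel is convex. -/
theorem integral_mul_heatConv_self_convex (hτ : 0 < τ) (hf : Integrable f) (hg : Integrable g)
    {θ : ℝ} (hθ : θ ∈ Set.Icc (0 : ℝ) 1) :
    ∫ x, (θ * f x + (1 - θ) * g x) * heatConv d τ (fun y => θ * f y + (1 - θ) * g y) x ≤
      θ * (∫ x, f x * heatConv d τ f x) + (1 - θ) * ∫ x, g x * heatConv d τ g x := by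
  have hdiff : Integrable fun x => 1 * f x + (-1) * g x := (hf.const_mul 1).add (hg.const_mul (-1))
  have hnonneg := integral_mul_heatConv_self_nonneg hτ hdiff
  have hf' := (integrable_mul_heatConv hτ hf hf).const_mul θ
  have hg' := (integrable_mul_heatConv hτ hg hg).const_mul (1 - θ)
  have hd' := (integrable_mul_heatConv hτ hdiff hdiff).const_mul (θ * (1 - θ))
  have hpolar :
      ∫ x, (θ * f x + (1 - θ) * g x) * heatConv d τ (fun y => θ * f y + (1 - θ) * g y) x =
      θ * (∫ x, f x * heatConv d τ f x) + (1 - θ) * (∫ x, g x * heatConv d τ g x) -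
        θ * (1 - θ) * ∫ x, (1 * f x + (-1) * g x) *
          heatConv d τ (fun y => 1 * f y + (-1) * g y) x := by
    rw [← integral_const_mul, ← integral_const_mul, ← integral_const_mul,
      ← integral_add hf' hg']
    refine Eq.trans ?_ (integral_sub (hf'.add hg') hd')
    congr with x
    simp only [heatConv_linear_combination hτ hf hg]
    ring
  rw [hpolar]
  exact sub_le_self _ (mul_nonneg (mul_nonneg hθ.1 (sub_nonneg.2 hθ.2)) hnonneg)

theorem multiEnergy_eq {n : ℕ} (hτ : 0 < τ) {u : Fin n → EuclideanSpace ℝ (Fin d) → ℝ}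
    (hu : ∀ i, Integrable (u i)) :
    multiEnergy d n τ u = 2 * (∑ i, ∫ x, u i x) -
      (∫ x, (∑ i, u i x) * heatConv d τ (fun y => ∑ i, u i y) x) -
      ∑ i, ∫ x, u i x * heatConv d τ (u i) x := by
  have hsum : Integrable fun x => ∑ i, u i x := integrable_finsetSum _ fun i _ => hu i
  have hext : ∫ x, (1 - ∑ i, u i x) * (1 - heatConv d τ (fun y => 1 - ∑ i, u i y) x) =
      (∑ i, ∫ x, u i x) - ∫ x, (∑ i, u i x) * heatConv d τ (fun y => ∑ i, u i y) x := by
    simp only [heatConv_one_sub hτ hsum, sub_sub_cancel, sub_mul, one_mul]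
    rw [integral_sub (integrable_heatConv hτ hsum) (integrable_mul_heatConv hτ hsum hsum),
      integral_heatConv hτ hsum, integral_finsetSum _ fun i _ => hu i]
  have hphase (i : Fin n) : ∫ x, u i x * (1 - heatConv d τ (u i) x) =
      (∫ x, u i x) - ∫ x, u i x * heatConv d τ (u i) x := by
    simp only [mul_sub, mul_one]
    exact integral_sub (hu i) (integrable_mul_heatConv hτ (hu i) (hu i))
  simp only [multiEnergy, hext, hphase, Finset.sum_sub_distrib]
  ring

end HeatConv

/-- The multiphase threshold-dynamics energy `E^τ` is concave on the convex set of tuples of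
integrable measurable `[0,1]`-valued functions whose sum is a.e. at most one. -/
theorem multiEnergy_concave (d n : ℕ) (hd : 1 ≤ d) (hn : 1 ≤ n) (τ : ℝ) (hτ : 0 < τ)
    (u v : Fin n → EuclideanSpace ℝ (Fin d) → ℝ)
    (hu_meas : ∀ i, Measurable (u i)) (hv_meas : ∀ i, Measurable (v i))
    (hu_int : ∀ i, Integrable (u i)) (hv_int : ∀ i, Integrable (v i))
    (hu01 : ∀ i x, u i x ∈ Set.Icc (0 : ℝ) 1) (hv01 : ∀ i x, v i x ∈ Set.Icc (0 : ℝ) 1)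
    (hu_sum : ∀ᵐ x, ∑ i, u i x ≤ 1) (hv_sum : ∀ᵐ x, ∑ i, v i x ≤ 1)
    (θ : ℝ) (hθ : θ ∈ Set.Icc (0 : ℝ) 1) :
    θ * multiEnergy d n τ u + (1 - θ) * multiEnergy d n τ v
      ≤ multiEnergy d n τ (fun i x => θ * u i x + (1 - θ) * v i x) := by
  have hw_int (i : Fin n) : Integrable fun x => θ * u i x + (1 - θ) * v i x :=
    ((hu_int i).const_mul θ).add ((hv_int i).const_mul (1 - θ))
  have hsum_u : Integrable fun x => ∑ i, u i x := integrable_finsetSum _ fun i _ => hu_int i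
  have hsum_v : Integrable fun x => ∑ i, v i x := integrable_finsetSum _ fun i _ => hv_int i
  rw [multiEnergy_eq hτ hu_int, multiEnergy_eq hτ hv_int, multiEnergy_eq hτ hw_int]
  have hlin : ∑ i, ∫ x, θ * u i x + (1 - θ) * v i x =
      θ * (∑ i, ∫ x, u i x) + (1 - θ) * ∑ i, ∫ x, v i x := by
    rw [Finset.mul_sum, Finset.mul_sum, ← Finset.sum_add_distrib]
    refine Finset.sum_congr rfl fun i _ => ?_
    rw [integral_add ((hu_int i).const_mul θ) ((hv_int i).const_mul (1 - θ)),
      integral_const_mul, integral_const_mul]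
  have hext := integral_mul_heatConv_self_convex hτ hsum_u hsum_v hθ
  have hphase := Finset.sum_le_sum fun i (_ : i ∈ Finset.univ) =>
    integral_mul_heatConv_self_convex hτ (hu_int i) (hv_int i) hθ
  simp only [Finset.sum_add_distrib, ← Finset.mul_sum] at hphase
  simp only [Finset.sum_add_distrib, ← Finset.mul_sum] at hlin ⊢
  rw [hlin]
  linarith
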